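/- For all d, k ≥ 1 there exists a constant C_{d,k} > 0 with the following property: if A ⊆ ℝ^d is a measurable set of positive finite volume such that |k·A| < (1^d + 2^d + ⋯ + k^d)·|A|, then |co(A)| ≤ C_{d,k}·|A|. -/

import Mathlib

open MeasureTheory Pointwise ENNReal

/-- The `k`-fold iterated Minkowski sumset `k·A = A + ⋯ + A` (`k` summands),
defined for `k ≥ 1` (and as `∅` for `k = 0`). -/
def kSum {α : Type*} [Add α] : ℕ → Set α → Set α
  | 0, _ => ∅
  | 1, A => A
  | n + 2, A => kSum (n + 1) A + A

/-- The integers, as a subset of the real line. -/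
def intSet : Set ℝ := Set.range ((↑) : ℤ → ℝ)

/-- The measure of the image of `X ⊆ ℝ` in the circle `ℝ/ℤ`. -/
noncomputable def circleMeas (X : Set ℝ) : ℝ≥0∞ := volume ((X + intSet) ∩ Set.Ico 0 1)

lemma isClosed_add_intSet {X : Set ℝ} (hX : IsCompact X) : IsClosed (X + intSet) :=
  Int.isClosedEmbedding_coe_real.isClosed_range.add_left_of_isCompact hX

lemma volume_le_circleMeas {X : Set ℝ} (hX : IsCompact X)
    (h : ∀ x ∈ X, ∀ y ∈ X, |x - y| ≤ 1) : volume X ≤ circleMeas X := by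
  rcases X.eq_empty_or_nonempty with rfl | hne
  · simp
  obtain ⟨a, haX, ha⟩ := hX.exists_isLeast hne
  have hsub : X ⊆ Set.Icc a (a + 1) := fun x hx => by
    have := h x hx a haX
    have h2 := ha hx
    rw [abs_le] at this
    exact ⟨h2, by linarith⟩
  have hsub' : X ⊆ X + intSet := fun x hx => ⟨x, hx, 0, ⟨0, by simp⟩, by simp⟩
  have hm : MeasurableSet (X + intSet) := (isClosed_add_intSet hX).measurableSet
  have key : volume ((X + intSet) ∩ Set.Ioc a (a + 1)) =
      volume ((X + intSet) ∩ Set.Ioc 0 (0 + 1)) := by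
    refine (isAddFundamentalDomain_Ioc one_pos a volume).measure_set_eq
      (isAddFundamentalDomain_Ioc one_pos 0 volume) hm ?_
    rintro ⟨g, hg⟩
    obtain ⟨n, rfl⟩ := AddSubgroup.mem_zmultiples_iff.1 hg
    ext x
    simp only [Set.mem_preimage]
    constructor
    · rintro ⟨y, hy, _, ⟨m, rfl⟩, hx⟩
      refine ⟨y, hy, _, ⟨m - n, rfl⟩, ?_⟩
      simp [AddSubgroup.vadd_def] at hx
      push_cast
      linarith
    · rintro ⟨y, hy, _, ⟨m, rfl⟩, hx⟩
      refine ⟨y, hy, _, ⟨m + n, rfl⟩, ?_⟩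
      simp [AddSubgroup.vadd_def] at hx ⊢
      linarith
  calc volume X ≤ volume ((X + intSet) ∩ Set.Icc a (a + 1)) :=
        measure_mono (Set.subset_inter hsub' hsub)
    _ = volume ((X + intSet) ∩ Set.Ioc a (a + 1)) :=
        measure_congr ((ae_eq_refl _).inter Ioc_ae_eq_Icc.symm)
    _ = volume ((X + intSet) ∩ Set.Ioc 0 1) := by rw [key, zero_add]
    _ = circleMeas X := measure_congr ((ae_eq_refl _).inter Ico_ae_eq_Ioc.symm)

/-- Residues modulo `p` of the cells of the grid `p⁻¹ ℤ` that meet `X`. -/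
def gridResidues (p : ℕ) (X : Set ℝ) : Set (ZMod p) :=
  (fun x : ℝ => ((⌊p * x⌋ : ℤ) : ZMod p)) '' X

lemma circleMeas_le_card_gridResidues {p : ℕ} (hp : p.Prime) (X : Set ℝ) (S : Finset (ZMod p))
    (hS : gridResidues p X ⊆ S) :
    circleMeas X ≤ S.card * ENNReal.ofReal (1 / p) := by
  have : NeZero p := ⟨hp.ne_zero⟩
  have hp0 : (0 : ℝ) < p := by exact_mod_cast hp.pos
  have hsub : (X + intSet) ∩ Set.Ico 0 1 ⊆
      ⋃ m ∈ S, Set.Ico ((m.val : ℝ) / p) ((m.val : ℝ) / p + 1 / p) := by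
    rintro _ ⟨⟨x, hx, _, ⟨n, rfl⟩, rfl⟩, h0, h1⟩
    simp only at h0 h1 ⊢
    have hmem := hS ⟨x, hx, rfl⟩
    simp only [Set.mem_iUnion]
    refine ⟨_, hmem, ?_⟩
    have hfl : ⌊(p : ℝ) * (x + n)⌋ = ⌊(p : ℝ) * x⌋ + p * n := by
      rw [mul_add, ← Int.floor_add_intCast]
      push_cast
      rfl
    have hb0 : 0 ≤ ⌊(p : ℝ) * (x + n)⌋ := Int.floor_nonneg.2 (by positivity)
    have hb1 : ⌊(p : ℝ) * (x + n)⌋ < p := by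
      rw [Int.floor_lt]
      push_cast
      nlinarith
    have hval : ((((⌊(p : ℝ) * x⌋ : ℤ) : ZMod p).val : ℤ)) = ⌊(p : ℝ) * (x + n)⌋ := by
      have : ((⌊(p : ℝ) * x⌋ : ℤ) : ZMod p) = ((⌊(p : ℝ) * (x + n)⌋ : ℤ) : ZMod p) := by
        rw [hfl]; simp
      rw [this, ZMod.val_intCast, Int.emod_eq_of_lt hb0 hb1]
    have hvalR : (((((⌊(p : ℝ) * x⌋ : ℤ) : ZMod p).val : ℕ)) : ℝ) = (⌊(p : ℝ) * (x + n)⌋ : ℝ) := by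
      exact_mod_cast congrArg (Int.cast : ℤ → ℝ) hval
    rw [hvalR, Set.mem_Ico, ← add_div, div_le_iff₀ hp0, lt_div_iff₀ hp0]
    constructor
    · have := Int.floor_le ((p : ℝ) * (x + n)); linarith
    · have := Int.lt_floor_add_one ((p : ℝ) * (x + n)); linarith
  calc circleMeas X ≤ volume (⋃ m ∈ S, Set.Ico ((m.val : ℝ) / p) ((m.val : ℝ) / p + 1 / p)) :=
        measure_mono hsub
    _ ≤ ∑ m ∈ S, volume (Set.Ico ((m.val : ℝ) / p) ((m.val : ℝ) / p + 1 / p)) :=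
        measure_biUnion_finset_le _ _
    _ = S.card * ENNReal.ofReal (1 / p) := by simp

lemma card_gridResidues_add_le {p : ℕ} (hp : p.Prime) (X Y : Set ℝ) (S T : Finset (ZMod p))
    (hS : (S : Set (ZMod p)) ⊆ gridResidues p X) (hT : (T : Set (ZMod p)) ⊆ gridResidues p Y) :
    (S + T).card * ENNReal.ofReal (1 / p) ≤
      volume (Metric.cthickening (2 / p) (X + Y + intSet) ∩ Set.Ico 0 1) := by
  have : NeZero p := ⟨hp.ne_zero⟩
  have hp0 : (0 : ℝ) < p := by exact_mod_cast hp.pos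
  have hsub : (⋃ m ∈ S + T, Set.Ico ((m.val : ℝ) / p) ((m.val : ℝ) / p + 1 / p)) ⊆
      Metric.cthickening (2 / p) (X + Y + intSet) ∩ Set.Ico 0 1 := by
    intro t ht
    simp only [Set.mem_iUnion] at ht
    obtain ⟨m, hm, ht0, ht1⟩ := ht
    rw [div_le_iff₀ hp0] at ht0
    rw [← add_div, lt_div_iff₀ hp0] at ht1
    have hv : (m.val : ℝ) + 1 ≤ p := by exact_mod_cast ZMod.val_lt m
    refine ⟨?_, ?_, ?_⟩
    · obtain ⟨s, hs, u, hu, rfl⟩ := Finset.mem_add.1 hm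
      obtain ⟨x, hx, rfl⟩ := hS hs
      obtain ⟨y, hy, rfl⟩ := hT hu
      set m := ((⌊(p : ℝ) * x⌋ : ℤ) : ZMod p) + ((⌊(p : ℝ) * y⌋ : ℤ) : ZMod p) with hmdef
      have hdvd : (p : ℤ) ∣ (m.val : ℤ) - (⌊(p : ℝ) * x⌋ + ⌊(p : ℝ) * y⌋) := by
        rw [← ZMod.intCast_zmod_eq_zero_iff_dvd]
        push_cast
        rw [ZMod.natCast_zmod_val, hmdef]
        ring
      obtain ⟨n, hn⟩ := hdvd
      have hnR : (m.val : ℝ) = (⌊(p : ℝ) * x⌋ : ℝ) + (⌊(p : ℝ) * y⌋ : ℝ) + p * n := by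
        have := congrArg (Int.cast : ℤ → ℝ) hn
        push_cast at this
        linarith
      refine Metric.mem_cthickening_of_dist_le t (x + y + n) _ _
        ⟨x + y, ⟨x, hx, y, hy, rfl⟩, n, ⟨n, rfl⟩, rfl⟩ ?_
      have h1 := Int.floor_le ((p : ℝ) * x)
      have h2 := Int.lt_floor_add_one ((p : ℝ) * x)
      have h3 := Int.floor_le ((p : ℝ) * y)
      have h4 := Int.lt_floor_add_one ((p : ℝ) * y)
      rw [Real.dist_eq, le_div_iff₀ hp0]
      nth_rewrite 1 [← abs_of_pos hp0]
      rw [← abs_mul, abs_le]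
      constructor <;> nlinarith
    · have : (0 : ℝ) ≤ m.val := by positivity
      by_contra! h
      nlinarith
    · by_contra! h
      nlinarith
  refine le_trans (le_of_eq ?_) (measure_mono hsub)
  rw [measure_biUnion_finset]
  · simp
  · intro a _ b _ hab
    refine Set.disjoint_left.2 fun t ha hb => hab ?_
    rw [Set.mem_Ico, div_le_iff₀ hp0, ← add_div, lt_div_iff₀ hp0] at ha hb
    apply ZMod.val_injective p
    have h1 : (a.val : ℝ) < b.val + 1 := by linarith
    have h2 : (b.val : ℝ) < a.val + 1 := by linarith
    norm_cast at h1 h2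
    omega
  · exact fun _ _ => measurableSet_Ico

/-- The Raikov–Macbeath inequality on the circle, for compact sets. -/
lemma min_circleMeas_add_le {X Y : Set ℝ} (hX : IsCompact X) (hY : IsCompact Y)
    (hX0 : X.Nonempty) (hY0 : Y.Nonempty) :
    min 1 (circleMeas X + circleMeas Y) ≤ circleMeas (X + Y) := by
  classical
  have hcl : IsClosed (X + Y + intSet) := isClosed_add_intSet (hX.add hY)
  set ν : Measure ℝ := volume.restrict (Set.Ico 0 1) with hν
  have : IsFiniteMeasure ν := ⟨by simp [hν]⟩
  have hlim := tendsto_measure_cthickening_of_isClosed (μ := ν) (s := X + Y + intSet)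
    ⟨1, one_pos, measure_ne_top _ _⟩ hcl
  have hz : Filter.Tendsto (fun p : ℕ => (2 : ℝ) / p) Filter.atTop (nhds 0) :=
    tendsto_const_div_atTop_nhds_zero_nat 2
  have hz1 : Filter.Tendsto (fun p : ℕ => ENNReal.ofReal (1 / (p : ℝ))) Filter.atTop (nhds 0) := by
    simpa using ENNReal.tendsto_ofReal (tendsto_const_div_atTop_nhds_zero_nat (1 : ℝ))
  have hL := (hlim.comp hz).add hz1
  rw [add_zero] at hL
  have htarget : ν (X + Y + intSet) = circleMeas (X + Y) :=
    Measure.restrict_apply hcl.measurableSet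
  rw [htarget] at hL
  refine ge_of_tendsto_of_frequently hL ?_
  have hfreq : ∃ᶠ p : ℕ in Filter.atTop, p.Prime :=
    Filter.frequently_atTop.2 fun a => by
      obtain ⟨p, hp, hpp⟩ := Nat.exists_infinite_primes a
      exact ⟨p, hp, hpp⟩
  refine hfreq.mono fun p hp => ?_
  have : NeZero p := ⟨hp.ne_zero⟩
  have hp0 : (0 : ℝ) < p := by exact_mod_cast hp.pos
  set S := (gridResidues p X).toFinset with hS
  set T := (gridResidues p Y).toFinset with hT
  have h1 := circleMeas_le_card_gridResidues hp X S (by simp [hS])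
  have h2 := circleMeas_le_card_gridResidues hp Y T (by simp [hT])
  have h3 := card_gridResidues_add_le hp X Y S T (by simp [hS]) (by simp [hT])
  have hcd := ZMod.cauchy_davenport hp (s := S) (t := T)
    (Set.toFinset_nonempty.2 (hX0.image _)) (Set.toFinset_nonempty.2 (hY0.image _))
  have hpp : (p : ℝ≥0∞) * ENNReal.ofReal (1 / p) = 1 := by
    rw [← ENNReal.ofReal_natCast, ← ENNReal.ofReal_mul hp0.le, mul_one_div_cancel hp0.ne',
      ENNReal.ofReal_one]
  have h4 : ν (Metric.cthickening (2 / p) (X + Y + intSet)) =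
      volume (Metric.cthickening (2 / p) (X + Y + intSet) ∩ Set.Ico 0 1) :=
    Measure.restrict_apply Metric.isClosed_cthickening.measurableSet
  simp only [Function.comp]
  rw [h4]
  refine le_trans ?_ (add_le_add_left h3 _)
  have hnat : p ≤ (S + T).card ∨ S.card + T.card ≤ (S + T).card + 1 := by omega
  rcases hnat with h | h
  · refine (min_le_left _ _).trans ?_
    rw [← hpp]
    refine le_trans ?_ le_self_add
    gcongr
  · refine (min_le_right _ _).trans ((add_le_add h1 h2).trans ?_)
    rw [← add_mul, ← Nat.cast_add]
    calc ((S.card + T.card : ℕ) : ℝ≥0∞) * ENNReal.ofReal (1 / p)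
        ≤ (((S + T).card + 1 : ℕ) : ℝ≥0∞) * ENNReal.ofReal (1 / p) := by gcongr
      _ = _ := by push_cast; ring

lemma kSum_succ {α : Type*} [Add α] {n : ℕ} (hn : 1 ≤ n) (A : Set α) :
    kSum (n + 1) A = kSum n A + A := by
  obtain ⟨m, rfl⟩ := Nat.exists_eq_add_of_le' hn
  rfl

lemma Set.Nonempty.kSum {α : Type*} [Add α] {A : Set α} (hA : A.Nonempty) {n : ℕ} (hn : 1 ≤ n) :
    (kSum n A).Nonempty := by
  induction n, hn using Nat.le_induction with
  | base => exact hA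
  | succ n hn ih => rw [kSum_succ hn]; exact ih.add hA

lemma IsCompact.kSum {α : Type*} [TopologicalSpace α] [Add α] [ContinuousAdd α] {A : Set α}
    (hA : IsCompact A) {n : ℕ} (hn : 1 ≤ n) : IsCompact (kSum n A) := by
  induction n, hn using Nat.le_induction with
  | base => exact hA
  | succ n hn ih => rw [kSum_succ hn]; exact ih.add hA

lemma kSum_mono {α : Type*} [Add α] {A B : Set α} (h : A ⊆ B) {n : ℕ} (hn : 1 ≤ n) :
    kSum n A ⊆ kSum n B := by
  induction n, hn using Nat.le_induction with
  | base => exact h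
  | succ n hn ih => rw [kSum_succ hn, kSum_succ hn]; exact Set.add_subset_add ih h

lemma min_mul_circleMeas_le {X : Set ℝ} (hX : IsCompact X) (hX0 : X.Nonempty) {n : ℕ}
    (hn : 1 ≤ n) : min 1 (n * circleMeas X) ≤ circleMeas (kSum n X) := by
  induction n, hn using Nat.le_induction with
  | base => simp [kSum]
  | succ n hn ih =>
    rw [kSum_succ hn]
    refine le_trans ?_ (min_circleMeas_add_le (hX.kSum hn) hX (hX0.kSum hn) hX0)
    refine le_min (min_le_left _ _) ?_
    push_cast
    rw [add_mul, one_mul]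
    rcases min_le_iff.1 ih with h | h
    · exact (min_le_left _ _).trans (h.trans le_self_add)
    · exact (min_le_right _ _).trans (add_le_add_left h _)

lemma mul_volume_le_circleMeas_kSum {X : Set ℝ} (hX : IsCompact X)
    (h : ∀ x ∈ X, ∀ y ∈ X, |x - y| ≤ 1) {n : ℕ} (hn : 1 ≤ n) (hv : n * volume X ≤ 1) :
    n * volume X ≤ circleMeas (kSum n X) := by
  rcases X.eq_empty_or_nonempty with rfl | hne
  · simp
  refine le_trans (le_min hv ?_) (min_mul_circleMeas_le hX hne hn)
  gcongr
  exact volume_le_circleMeas hX h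

section Sections

variable {ι : Type*}

/-- The slab that is a fundamental domain for translation by the `i`-th basis vector. -/
def unitSlab (i : ι) : Set (ι → ℝ) := {x | x i ∈ Set.Ico (0 : ℝ) 1}

lemma measurableSet_unitSlab (i : ι) : MeasurableSet (unitSlab i) :=
  measurable_pi_apply i measurableSet_Ico

lemma volume_preimage_sub_const [Fintype ι] (p : ι → ℝ) (S : Set (ι → ℝ)) :
    volume ((fun x => x - p) ⁻¹' S) = volume S := by
  simp_rw [sub_eq_add_neg]
  exact measure_preimage_add_right volume (-p) S

variable [DecidableEq ι]

/-- The section of `A` along the line through `x` in the direction of the `i`-th axis. -/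
def lineSection (A : Set (ι → ℝ)) (i : ι) (x : ι → ℝ) : Set ℝ := {t | Function.update x i t ∈ A}

lemma measurableSet_lineSection {A : Set (ι → ℝ)} (hA : MeasurableSet A) (i : ι) (x : ι → ℝ) :
    MeasurableSet (lineSection A i x) :=
  measurable_update x hA

lemma isCompact_lineSection {A : Set (ι → ℝ)} (hA : IsCompact A) (i : ι) (x : ι → ℝ) :
    IsCompact (lineSection A i x) := by
  refine (hA.image (continuous_apply i)).of_isClosed_subset
    (hA.isClosed.preimage (continuous_const.update i continuous_id)) fun t ht => ?_
  exact ⟨_, ht, by simp⟩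

lemma kSum_lineSection_subset (A : Set (ι → ℝ)) (i : ι) (x : ι → ℝ) {n : ℕ} (hn : 1 ≤ n) :
    kSum n (lineSection A i x) ⊆ lineSection (kSum n A) i ((n : ℝ) • x) := by
  induction n, hn using Nat.le_induction with
  | base => simp [kSum]
  | succ n hn ih =>
    rw [kSum_succ hn, kSum_succ hn]
    rintro _ ⟨s, hs, t, ht, rfl⟩
    refine ⟨_, ih hs, _, ht, ?_⟩
    ext l
    by_cases hl : l = i
    · subst hl; simp
    · simp [hl]; ring

/-- The union of all translates of `S` by integer multiples of the `i`-th basis vector. -/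
def periodization (S : Set (ι → ℝ)) (i : ι) : Set (ι → ℝ) :=
  ⋃ n : ℤ, (fun x => x - Pi.single i (n : ℝ)) ⁻¹' S

lemma measurableSet_periodization {S : Set (ι → ℝ)} (hS : MeasurableSet S) (i : ι) :
    MeasurableSet (periodization S i) :=
  MeasurableSet.iUnion fun _ => (measurable_id.sub_const _) hS

lemma lintegral_indicator_update {A : Set (ι → ℝ)} (hA : MeasurableSet A) (i : ι) (x : ι → ℝ) :
    ∫⁻ t, A.indicator (1 : (ι → ℝ) → ℝ≥0∞) (Function.update x i t) =
      volume (lineSection A i x) := by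
  rw [← lintegral_indicator_one (measurableSet_lineSection hA i x)]
  rfl

lemma circleMeas_lineSection_le (S : Set (ι → ℝ)) (i : ι) (x : ι → ℝ) :
    circleMeas (lineSection S i x) ≤ volume (lineSection (periodization S i ∩ unitSlab i) i x) := by
  refine measure_mono ?_
  rintro _ ⟨⟨t, ht, _, ⟨n, rfl⟩, rfl⟩, h⟩
  refine ⟨Set.mem_iUnion.2 ⟨n, ?_⟩, by simpa [unitSlab] using h⟩
  have : Function.update x i (t + n) - Pi.single i (n : ℝ) = Function.update x i t := by
    ext l
    by_cases hl : l = i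
    · subst hl; simp
    · simp [hl]
  rw [Set.mem_preimage, this]
  exact ht

lemma volume_lineSection_translate_le {A : Set (ι → ℝ)} {x : ι → ℝ} (hx : x ∈ A) (i : ι)
    (y : ι → ℝ) : volume (lineSection A i y) ≤
      volume (lineSection ((fun z => z - (-y)) ⁻¹' (A + A)) i x) := by
  rw [← measure_preimage_add_right volume (-(x i - y i)) (lineSection A i y)]
  refine measure_mono fun t ht => ⟨x, hx, _, ht, ?_⟩
  ext l
  by_cases hl : l = i
  · subst hl; simp; ring
  · simp [hl]

variable [Fintype ι]

lemma volume_le_of_lineSection_le {A B : Set (ι → ℝ)} (hA : MeasurableSet A)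
    (hB : MeasurableSet B) (i : ι)
    (h : ∀ x, volume (lineSection A i x) ≤ volume (lineSection B i x)) :
    volume A ≤ volume B := by
  rw [← lintegral_indicator_one hA, ← lintegral_indicator_one hB, volume_pi]
  refine lintegral_le_of_lmarginal_le {i} (measurable_one.indicator hA)
    (measurable_one.indicator hB) fun x => ?_
  rw [lmarginal_singleton, lmarginal_singleton]
  simp only [lintegral_indicator_update hA, lintegral_indicator_update hB]
  exact h x

lemma volume_periodization_inter_le {S : Set (ι → ℝ)} (hS : MeasurableSet S) (i : ι) :
    volume (periodization S i ∩ unitSlab i) ≤ volume S := by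
  have hm : ∀ n : ℤ, MeasurableSet
      (S ∩ (fun x : ι → ℝ => x + Pi.single i (n : ℝ)) ⁻¹' unitSlab i) := fun n =>
    hS.inter ((measurable_id.add_const _) (measurableSet_unitSlab i))
  have h1 : ∀ n : ℤ, volume (((fun x => x - Pi.single i (n : ℝ)) ⁻¹' S) ∩ unitSlab i) =
      volume (S ∩ (fun x : ι → ℝ => x + Pi.single i (n : ℝ)) ⁻¹' unitSlab i) := by
    intro n
    rw [eq_comm, ← volume_preimage_sub_const (Pi.single i (n : ℝ)), Set.preimage_inter,
      ← Set.preimage_comp]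
    congr 2
    ext x
    simp
  rw [periodization, Set.iUnion_inter]
  refine (measure_iUnion_le _).trans ?_
  simp_rw [h1]
  rw [← measure_iUnion _ hm]
  · exact measure_mono (Set.iUnion_subset fun n => Set.inter_subset_left)
  · intro m n hmn
    refine Set.disjoint_left.2 fun x hx hy => hmn ?_
    have h2 := hx.2
    have h3 := hy.2
    simp only [Set.mem_preimage, unitSlab, Set.mem_ofPred_eq, Pi.add_apply, Pi.single_eq_same,
      Set.mem_Ico] at h2 h3
    have h4 : (m : ℝ) < n + 1 := by linarith
    have h5 : (n : ℝ) < m + 1 := by linarith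
    norm_cast at h4 h5
    omega

lemma pow_mul_volume_le_of_short_sections {A : Set (ι → ℝ)} (hA : IsCompact A) {i : ι}
    (hdiam : ∀ x ∈ A, ∀ t : ℝ, x + Pi.single i t ∈ A → |t| ≤ 1) {n : ℕ} (hn : 1 ≤ n)
    (hshort : ∀ x, n * volume (lineSection A i x) ≤ 1) :
    (n : ℝ≥0∞) ^ Fintype.card ι * volume A ≤
      volume (periodization (kSum n A) i ∩ unitSlab i) := by
  have hn0 : (0 : ℝ) < n := by exact_mod_cast hn
  set U := periodization (kSum n A) i ∩ unitSlab i with hU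
  have hUm : MeasurableSet U :=
    (measurableSet_periodization (hA.kSum hn).measurableSet i).inter (measurableSet_unitSlab i)
  have hsec : ∀ x, volume (lineSection A i x) ≤
      volume (lineSection ((fun z => (n : ℝ) • z) ⁻¹' U) i x) := by
    intro x
    have h1 : lineSection ((fun z => (n : ℝ) • z) ⁻¹' U) i x =
        (fun t => (n : ℝ) * t) ⁻¹' lineSection U i ((n : ℝ) • x) := by
      ext t
      simp only [lineSection, Set.mem_preimage, Set.mem_ofPred_eq]
      rw [← smul_eq_mul, Function.update_smul]
    rw [h1, Real.volume_preimage_mul_left hn0.ne', abs_of_pos (inv_pos.2 hn0),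
      ENNReal.ofReal_inv_of_pos hn0, ENNReal.ofReal_natCast, mul_comm, ← div_eq_mul_inv,
      ENNReal.le_div_iff_mul_le (Or.inl (by simpa using hn0.ne')) (Or.inl (by simp)), mul_comm]
    refine (mul_volume_le_circleMeas_kSum (isCompact_lineSection hA i x) ?_ hn (hshort x)).trans
      ((measure_mono ?_).trans (circleMeas_lineSection_le _ _ _))
    · intro s hs t ht
      refine hdiam _ ht _ ?_
      have : Function.update x i t + Pi.single i (s - t) = Function.update x i s := by
        ext l
        by_cases hl : l = i
        · subst hl; simp
        · simp [hl]
      rw [this]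
      exact hs
    · exact Set.inter_subset_inter_left _
        (Set.add_subset_add_right (kSum_lineSection_subset A i x hn))
  have hvol : volume A ≤ volume (((n : ℝ) • ·) ⁻¹' U) :=
    volume_le_of_lineSection_le hA.measurableSet ((measurable_id.const_smul (n : ℝ)) hUm) i hsec
  have hpow : (0 : ℝ) < (n : ℝ) ^ Fintype.card ι := by positivity
  rw [Measure.addHaar_preimage_smul volume hn0.ne', Module.finrank_fintype_fun_eq_card,
    abs_of_pos (inv_pos.2 hpow), ENNReal.ofReal_inv_of_pos hpow,
    ENNReal.ofReal_pow hn0.le, ENNReal.ofReal_natCast, mul_comm, ← div_eq_mul_inv,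
    ENNReal.le_div_iff_mul_le (Or.inl (pow_ne_zero _ (by exact_mod_cast hn0.ne')))
      (Or.inl (ENNReal.pow_ne_top (by simp))), mul_comm] at hvol
  exact hvol

lemma volume_kSum_add_le {A : Set (ι → ℝ)} (hA : IsCompact A) {i : ι} {p : ι → ℝ} (hp : p ∈ A)
    (hp' : p + Pi.single i 1 ∈ A) {n : ℕ} (hn : 1 ≤ n) :
    volume (kSum n A) + volume (periodization (kSum (n + 1) A) i ∩ unitSlab i) ≤
      volume (kSum (n + 1) A) := by
  have hc := hA.kSum hn
  have hc' := hA.kSum (Nat.le_add_left 1 n)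
  set T := (fun x => x - p) ⁻¹' kSum n A with hT
  have hTm : MeasurableSet T := (measurable_id.sub_const _) hc.measurableSet
  have hsum : ∀ x ∈ T, x ∈ kSum (n + 1) A ∧ x + Pi.single i 1 ∈ kSum (n + 1) A := by
    intro x hx
    rw [kSum_succ hn]
    exact ⟨⟨_, hx, _, hp, by simp⟩, ⟨_, hx, _, hp', by simp only; abel⟩⟩
  have hTsub : T ⊆ kSum (n + 1) A := fun x hx => (hsum x hx).1
  have hTv : volume T = volume (kSum n A) := volume_preimage_sub_const p _
  have hper : periodization (kSum (n + 1) A) i ⊆ periodization (kSum (n + 1) A \ T) i := by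
    intro x hx
    obtain ⟨m, hm⟩ := Set.mem_iUnion.1 hx
    obtain ⟨M, hM⟩ := (hc'.image (continuous_apply i)).bddAbove
    obtain ⟨N, hN⟩ := exists_int_gt (M - x i)
    obtain ⟨q, hq, hqmax⟩ := Int.exists_greatest_of_bdd
      (P := fun q : ℤ => x + Pi.single i (q : ℝ) ∈ kSum (n + 1) A)
      ⟨N, fun q hq => by
        have h1 := hM ⟨_, hq, rfl⟩
        simp only [Pi.add_apply, Pi.single_eq_same] at h1
        have : (q : ℝ) < N := by linarith
        exact_mod_cast this.le⟩
      ⟨-m, by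
        have : x - Pi.single i (m : ℝ) ∈ kSum (n + 1) A := hm
        rw [sub_eq_add_neg, ← Pi.single_neg] at this
        exact_mod_cast this⟩
    refine Set.mem_iUnion.2 ⟨-q, ?_⟩
    have hx' : x - Pi.single i ((-q : ℤ) : ℝ) = x + Pi.single i (q : ℝ) := by
      push_cast
      rw [Pi.single_neg, sub_neg_eq_add]
    rw [Set.mem_preimage, hx']
    refine ⟨hq, fun hqT => ?_⟩
    have h2 := (hsum _ hqT).2
    rw [add_assoc, ← Pi.single_add] at h2
    have := hqmax (q + 1) (by push_cast; exact h2)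
    omega
  calc volume (kSum n A) + volume (periodization (kSum (n + 1) A) i ∩ unitSlab i)
      ≤ volume T + volume (kSum (n + 1) A \ T) := by
        rw [hTv]
        refine add_le_add_right ?_ _
        exact (measure_mono (Set.inter_subset_inter_left _ hper)).trans
          (volume_periodization_inter_le (hc'.measurableSet.diff hTm) i)
    _ = volume (kSum (n + 1) A) := by
        rw [measure_add_sdiff hTm.nullMeasurableSet, Set.union_eq_self_of_subset_left hTsub]

/-- If all sections of `A` in one coordinate direction are short and lie in a segment whose ends
differ by the basis vector, then the iterated sumset is as large as for a far away point. -/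
lemma sum_pow_mul_volume_le_volume_kSum {A : Set (ι → ℝ)} (hA : IsCompact A) {i : ι} {p : ι → ℝ}
    (hp : p ∈ A) (hp' : p + Pi.single i 1 ∈ A)
    (hdiam : ∀ x ∈ A, ∀ t : ℝ, x + Pi.single i t ∈ A → |t| ≤ 1) {k : ℕ} (hk : 1 ≤ k)
    (hshort : ∀ x, k * volume (lineSection A i x) ≤ 1) :
    (∑ j ∈ Finset.Icc 1 k, (j : ℝ≥0∞) ^ Fintype.card ι) * volume A ≤ volume (kSum k A) := by
  induction k, hk using Nat.le_induction with
  | base => simp [kSum]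
  | succ n hn ih =>
    rw [Finset.sum_Icc_succ_top (by omega), add_mul]
    refine le_trans (add_le_add (ih fun x => ?_) ?_) (volume_kSum_add_le hA hp hp' hn)
    · refine le_trans ?_ (hshort x)
      gcongr
      simp
    · exact pow_mul_volume_le_of_short_sections hA hdiam (Nat.le_add_left 1 n) hshort

lemma volume_kSum_mono {A : Set (ι → ℝ)} (hA : IsCompact A) {i : ι} {p : ι → ℝ} (hp : p ∈ A)
    (hp' : p + Pi.single i 1 ∈ A) {m n : ℕ} (hm : 1 ≤ m) (hmn : m ≤ n) :
    volume (kSum m A) ≤ volume (kSum n A) := by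
  induction n, hmn using Nat.le_induction with
  | base => exact le_rfl
  | succ n hn ih => exact ih.trans (le_self_add.trans (volume_kSum_add_le hA hp hp' (hm.trans hn)))

/-- A discrete Loomis–Whitney type estimate: a set with long sections in every coordinate
direction and with small doubling has volume bounded below. -/
lemma one_le_mul_volume_of_long_sections [Nonempty ι] {A : Set (ι → ℝ)} (hA : IsCompact A)
    (hA0 : volume A ≠ 0) {c K : ℝ≥0∞} (hc : c ≠ 0) (hc' : c ≠ ⊤) (y : ι → ι → ℝ)
    (hy : ∀ i, 1 ≤ c * volume (lineSection A i (y i)))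
    (hK : volume (A + A) ≤ K * volume A) :
    1 ≤ (c * (1 + Fintype.card ι * K)) ^ Fintype.card ι * (1 + Fintype.card ι * K) * volume A := by
  set n := Fintype.card ι with hn
  have hn0 : (0 : ℝ) < n := by exact_mod_cast Fintype.card_pos
  set M := 1 + (n : ℝ≥0∞) * K with hM
  set B : ι → Set (ι → ℝ) := fun i => (fun z => z - (-y i)) ⁻¹' (A + A) with hB
  have hAm := hA.measurableSet
  have hBm : ∀ i, MeasurableSet (B i) := fun i =>
    (measurable_id.sub_const _) (hA.add hA).measurableSet
  set f : (ι → ℝ) → ℝ≥0∞ := fun x => A.indicator 1 x + ∑ i, (B i).indicator 1 x with hf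
  have hfm : Measurable f := (measurable_one.indicator hAm).add
    (Finset.measurable_sum _ fun i _ => measurable_one.indicator (hBm i))
  have hint : ∫⁻ x, f x ≤ M * volume A := by
    rw [hf, lintegral_add_left (measurable_one.indicator hAm),
      lintegral_finsetSum _ fun i _ => measurable_one.indicator (hBm i),
      lintegral_indicator_one hAm, hM, add_mul, one_mul]
    simp_rw [lintegral_indicator_one (hBm _), hB, volume_preimage_sub_const]
    rw [Finset.sum_const, Finset.card_univ, nsmul_eq_mul, mul_assoc]
    gcongr
  have hline : ∀ x ∈ A, ∀ i, c⁻¹ ≤ ∫⁻ t, f (Function.update x i t) := by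
    intro x hx i
    calc c⁻¹ ≤ volume (lineSection A i (y i)) := by
          rw [ENNReal.inv_le_iff_le_mul (fun _ => hc) (fun h => absurd h hc')]
          exact hy i
      _ ≤ volume (lineSection (B i) i x) := volume_lineSection_translate_le hx i (y i)
      _ = ∫⁻ t, (B i).indicator 1 (Function.update x i t) :=
          (lintegral_indicator_update (hBm i) i x).symm
      _ ≤ ∫⁻ t, f (Function.update x i t) := lintegral_mono fun t =>
          (Finset.single_le_sum (f := fun i => (B i).indicator (1 : (ι → ℝ) → ℝ≥0∞) _)
            (fun _ _ => zero_le) (Finset.mem_univ i)).trans le_add_self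
  have hgrid := lintegral_mul_prod_lintegral_pow_le (fun _ : ι => (volume : Measure ℝ))
    (p := (n : ℝ)⁻¹) (by positivity)
    (by rw [← div_eq_mul_inv, div_le_one hn0]; simp [hn]) hfm
  rw [← volume_pi] at hgrid
  have hlow : c⁻¹ * volume A ≤ ∫⁻ x, f x ^ (1 - ((Fintype.card ι : ℝ) - 1) * (n : ℝ)⁻¹) *
      ∏ i, (∫⁻ t, f (Function.update x i t)) ^ (n : ℝ)⁻¹ := by
    rw [← setLIntegral_const]
    refine (setLIntegral_mono' hAm fun x hx => ?_).trans (setLIntegral_le_lintegral A _)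
    have hfx : 1 ≤ f x := by simp [hf, hx]
    have hexp : 0 ≤ 1 - ((Fintype.card ι : ℝ) - 1) * (n : ℝ)⁻¹ := by
      rw [← hn, sub_nonneg, ← div_eq_mul_inv, div_le_one hn0]; simp
    calc c⁻¹ = 1 * ∏ _i : ι, c⁻¹ ^ (n : ℝ)⁻¹ := by
          rw [Finset.prod_const, Finset.card_univ, ← hn, one_mul, ← ENNReal.rpow_natCast,
            ← ENNReal.rpow_mul, inv_mul_cancel₀ hn0.ne', ENNReal.rpow_one]
      _ ≤ _ := by
          refine mul_le_mul' ?_ (Finset.prod_le_prod' fun i _ => ?_)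
          · exact (ENNReal.one_rpow _).symm.le.trans (ENNReal.rpow_le_rpow hfx hexp)
          · exact ENNReal.rpow_le_rpow (hline x hx i) (by positivity)
  have hA1 : volume A ≠ ⊤ := hA.measure_lt_top.ne
  have hmain : c⁻¹ * volume A ≤ (M * (M * volume A) ^ (n : ℝ)⁻¹) * volume A := by
    calc c⁻¹ * volume A ≤ (M * volume A) ^ (1 + (n : ℝ)⁻¹) :=
          (hlow.trans hgrid).trans (ENNReal.rpow_le_rpow hint (by positivity))
      _ = _ := by
          rw [ENNReal.rpow_add_of_nonneg _ _ zero_le_one (by positivity), ENNReal.rpow_one]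
          ring
  have h1 : c⁻¹ ≤ M * (M * volume A) ^ (n : ℝ)⁻¹ :=
    (ENNReal.mul_le_mul_iff_left hA0 hA1).1 hmain
  rw [ENNReal.inv_le_iff_le_mul (fun _ => hc) (fun h => absurd h hc')] at h1
  calc (1 : ℝ≥0∞) = 1 ^ n := (one_pow n).symm
    _ ≤ (c * (M * (M * volume A) ^ (n : ℝ)⁻¹)) ^ n := by gcongr
    _ = (c * M) ^ n * ((M * volume A) ^ (n : ℝ)⁻¹) ^ n := by rw [← mul_assoc, mul_pow]
    _ = (c * M) ^ n * M * volume A := by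
      rw [← ENNReal.rpow_natCast (_ ^ _), ← ENNReal.rpow_mul, inv_mul_cancel₀ hn0.ne',
        ENNReal.rpow_one, mul_assoc]

/-- The sum `1^d + 2^d + ⋯ + k^d`. -/
noncomputable def powerSum (d k : ℕ) : ℝ≥0∞ := ∑ i ∈ Finset.Icc 1 k, (i : ℝ≥0∞) ^ d

/-- The constant in the volume bound for sets normalized in every coordinate direction. -/
noncomputable def normalizedConst (d k : ℕ) : ℝ≥0∞ :=
  (k * (1 + d * powerSum d k)) ^ d * (1 + d * powerSum d k)

lemma one_le_normalizedConst_mul_volume [Nonempty ι] {A : Set (ι → ℝ)} (hA : IsCompact A)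
    (hend : ∀ i, ∃ p ∈ A, p + Pi.single i 1 ∈ A)
    (hdiam : ∀ i, ∀ x ∈ A, ∀ t : ℝ, x + Pi.single i t ∈ A → |t| ≤ 1) {k : ℕ} (hk : 1 ≤ k)
    (hsum : volume (kSum k A) < powerSum (Fintype.card ι) k * volume A) :
    1 ≤ normalizedConst (Fintype.card ι) k * volume A := by
  have hlong : ∀ i, ∃ y, 1 ≤ (k : ℝ≥0∞) * volume (lineSection A i y) := by
    intro i
    by_contra! h
    obtain ⟨p, hp, hp'⟩ := hend i
    exact hsum.not_ge (sum_pow_mul_volume_le_volume_kSum hA hp hp' (hdiam i) hk fun x => (h x).le)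
  choose y hy using hlong
  have hk2 : 2 ≤ k := by
    by_contra! h
    obtain rfl : k = 1 := by omega
    simp [kSum, powerSum] at hsum
  have hA0 : volume A ≠ 0 := fun h => by simp [h] at hsum
  obtain ⟨p, hp, hp'⟩ := hend (Classical.arbitrary ι)
  have hK : volume (A + A) ≤ powerSum (Fintype.card ι) k * volume A :=
    (volume_kSum_mono hA hp hp' one_le_two hk2).trans hsum.le
  exact one_le_mul_volume_of_long_sections hA hA0 (by exact_mod_cast (by omega : k ≠ 0))
    (by simp) y hy hK

end Sections

lemma kSum_image {E F G : Type*} [AddCommMonoid E] [AddCommMonoid F] [FunLike G E F]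
    [AddMonoidHomClass G E F] (f : G) (A : Set E) {n : ℕ} (hn : 1 ≤ n) :
    kSum n (f '' A) = f '' kSum n A := by
  induction n, hn using Nat.le_induction with
  | base => rfl
  | succ n hn ih => rw [kSum_succ hn, kSum_succ hn, ih, Set.image_add]

section Normalization

variable {d : ℕ}

lemma exists_map_ne_of_volume_ne_zero {A : Set (Fin d → ℝ)} (hA0 : volume A ≠ 0)
    {f : (Fin d → ℝ) →ₗ[ℝ] ℝ} (hf : f ≠ 0) : ∃ x ∈ A, ∃ y ∈ A, f x ≠ f y := by
  by_contra! h
  apply hA0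
  obtain ⟨a, ha⟩ : A.Nonempty := Set.nonempty_iff_ne_empty.2 fun h => hA0 (by simp [h])
  refine measure_mono_null (t := (fun x => x - a) ⁻¹' (LinearMap.ker f : Set (Fin d → ℝ)))
    (fun x hx => ?_) ?_
  · simp [h x hx a ha]
  · rw [volume_preimage_sub_const]
    exact Measure.addHaar_submodule volume _ (by rwa [Ne, LinearMap.ker_eq_top])

/-- Vectors `v i` joining two points of `A` that realize the width of `A` with respect to
functionals `ℓ i`, normalized to have width one, in triangular position. -/
def IsWidthSystem (A : Set (Fin d → ℝ)) (m : ℕ) (v : ℕ → Fin d → ℝ)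
    (ℓ : ℕ → (Fin d → ℝ) →ₗ[ℝ] ℝ) : Prop :=
  ∀ i < m, ℓ i (v i) = 1 ∧ (∀ j < i, ℓ i (v j) = 0) ∧
    (∀ x ∈ A, ∀ y ∈ A, |ℓ i x - ℓ i y| ≤ 1) ∧ ∃ p ∈ A, p + v i ∈ A

lemma exists_isWidthSystem {A : Set (Fin d → ℝ)} (hA : IsCompact A) (hA0 : volume A ≠ 0) {m : ℕ}
    (hm : m ≤ d) : ∃ v ℓ, IsWidthSystem A m v ℓ := by
  induction m with
  | zero => exact ⟨0, 0, fun i hi => absurd hi (by omega)⟩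
  | succ m ih =>
    obtain ⟨v, ℓ, h⟩ := ih (by omega)
    have hlt : Submodule.span ℝ (Set.range fun j : Fin m => v j) < ⊤ := by
      refine lt_top_iff_ne_top.2 fun htop => ?_
      have h1 := finrank_range_le_card (R := ℝ) fun j : Fin m => v j
      rw [Set.finrank, htop, finrank_top, Module.finrank_fin_fun, Fintype.card_fin] at h1
      omega
    obtain ⟨f, hf0, hf⟩ := Submodule.exists_le_ker_of_lt_top _ hlt
    have hne : A.Nonempty := Set.nonempty_iff_ne_empty.2 fun h => hA0 (by simp [h])
    have hfc : ContinuousOn f A := f.continuous_of_finiteDimensional.continuousOn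
    obtain ⟨p, hp, hpmin⟩ := hA.exists_isMinOn hne hfc
    obtain ⟨q, hq, hqmax⟩ := hA.exists_isMaxOn hne hfc
    have hmin : ∀ x ∈ A, f p ≤ f x := fun x hx => hpmin hx
    have hmax : ∀ x ∈ A, f x ≤ f q := fun x hx => hqmax hx
    have hw : 0 < f q - f p := by
      obtain ⟨x, hx, y, hy, hxy⟩ := exists_map_ne_of_volume_ne_zero hA0 hf0
      by_contra! hle
      apply hxy
      have := hmin x hx
      have := hmin y hy
      have := hmax x hx
      have := hmax y hy
      linarith
    refine ⟨Function.update v m (q - p), Function.update ℓ m ((f q - f p)⁻¹ • f), fun i hi => ?_⟩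
    rcases Nat.lt_succ_iff_lt_or_eq.1 hi with hi | rfl
    · have hv : ∀ j ≤ i, Function.update v m (q - p) j = v j := fun j hj =>
        Function.update_of_ne (by omega) _ _
      rw [Function.update_of_ne hi.ne, hv i le_rfl]
      obtain ⟨h1, h2, h3⟩ := h i hi
      exact ⟨h1, fun j hj => by rw [hv j hj.le, h2 j hj], h3⟩
    · rw [Function.update_self, Function.update_self]
      refine ⟨?_, fun j hj => ?_, fun x hx y hy => ?_, p, hp, by simpa using hq⟩
      · simp [inv_mul_cancel₀ hw.ne']
      · rw [Function.update_of_ne hj.ne]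
        have : f (v j) = 0 := hf (Submodule.subset_span ⟨⟨j, hj⟩, rfl⟩)
        simp [this]
      · rw [LinearMap.smul_apply, LinearMap.smul_apply, ← smul_sub, smul_eq_mul, abs_mul,
          abs_of_pos (inv_pos.2 hw), inv_mul_le_iff₀ hw, mul_one, abs_le]
        have := hmin x hx
        have := hmin y hy
        have := hmax x hx
        have := hmax y hy
        constructor <;> linarith

/-- A compact set of positive volume can be normalized by a linear map so that it has unit width
in every coordinate direction while its convex hull has bounded volume. -/
lemma exists_normalization {A : Set (Fin d → ℝ)} (hA : IsCompact A) (hA0 : volume A ≠ 0) :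
    ∃ T : (Fin d → ℝ) →ₗ[ℝ] (Fin d → ℝ), LinearMap.det T ≠ 0 ∧
      (∀ i, ∃ p ∈ T '' A, p + Pi.single i 1 ∈ T '' A) ∧
      (∀ i, ∀ x ∈ T '' A, ∀ t : ℝ, x + Pi.single i t ∈ T '' A → |t| ≤ 1) ∧
      volume (convexHull ℝ (T '' A)) ≤ 2 ^ d := by
  obtain ⟨v, ℓ, h⟩ := exists_isWidthSystem hA hA0 le_rfl
  obtain ⟨a, ha⟩ : A.Nonempty := Set.nonempty_iff_ne_empty.2 fun h => hA0 (by simp [h])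
  set V : (Fin d → ℝ) →ₗ[ℝ] (Fin d → ℝ) := Fintype.linearCombination ℝ fun j : Fin d => v j with hV
  set L : (Fin d → ℝ) →ₗ[ℝ] (Fin d → ℝ) := LinearMap.pi fun i : Fin d => ℓ i with hL
  have hVs : ∀ (i : Fin d) (t : ℝ), V (Pi.single i t) = t • v i := fun i t => by
    simp [hV, Fintype.linearCombination_apply_single]
  have hdet : LinearMap.det (L ∘ₗ V) = 1 := by
    rw [← LinearMap.det_toMatrix', Matrix.det_of_isUpperTriangular]
    · refine Finset.prod_eq_one fun i _ => ?_
      rw [LinearMap.toMatrix'_apply, LinearMap.comp_apply, hVs]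
      simpa [hL] using (h i i.2).1
    · intro i j hij
      rw [LinearMap.toMatrix'_apply, LinearMap.comp_apply, hVs]
      simpa [hL] using (h i i.2).2.1 j hij
  rw [LinearMap.det_comp] at hdet
  have hVdet : LinearMap.det V ≠ 0 := right_ne_zero_of_mul_eq_one hdet
  set e := V.equivOfDetNeZero hVdet with he
  have heV : ∀ x, e.symm (V x) = x := fun x => e.symm_apply_apply x
  have hVe : ∀ x, V (e.symm x) = x := fun x => e.apply_symm_apply x
  have hTdet : LinearMap.det (e.symm : (Fin d → ℝ) →ₗ[ℝ] (Fin d → ℝ)) = LinearMap.det L := by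
    have h1 : LinearMap.det (e.symm : (Fin d → ℝ) →ₗ[ℝ] (Fin d → ℝ)) * LinearMap.det V = 1 := by
      rw [← LinearMap.det_comp,
        show (e.symm : (Fin d → ℝ) →ₗ[ℝ] (Fin d → ℝ)) ∘ₗ V = LinearMap.id from LinearMap.ext heV,
        LinearMap.det_id]
    exact mul_right_cancel₀ hVdet (h1.trans hdet.symm)
  refine ⟨e.symm, hTdet ▸ left_ne_zero_of_mul_eq_one hdet, fun i => ?_, ?_, ?_⟩
  · obtain ⟨p, hp, hp'⟩ := (h i i.2).2.2.2
    refine ⟨e.symm p, ⟨p, hp, rfl⟩, p + v i, hp', ?_⟩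
    have : e.symm (v i) = Pi.single i 1 := by rw [← heV (Pi.single i 1), hVs, one_smul]
    simp [this]
  · rintro i _ ⟨x, hx, rfl⟩ t ⟨y, hy, hxy⟩
    have h1 : y = x + t • v i := by
      have := congrArg V hxy
      simpa [hVe, hVs] using this
    have h2 := (h i i.2).2.2.1 y hy x hx
    rw [h1, map_add, map_smul, (h i i.2).1] at h2
    simpa using h2
  · have hsub : convexHull ℝ (L '' A) ⊆ Metric.closedBall (L a) 1 := by
      refine convexHull_min ?_ (convex_closedBall _ _)
      rintro _ ⟨x, hx, rfl⟩
      rw [Metric.mem_closedBall, dist_pi_le_iff zero_le_one]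
      exact fun i => (h i i.2).2.2.1 x hx a ha
    rw [← LinearMap.image_convexHull, Measure.addHaar_image_linearMap, hTdet,
      ← Measure.addHaar_image_linearMap, LinearMap.image_convexHull]
    refine (measure_mono hsub).trans ?_
    rw [Real.volume_pi_closedBall _ zero_le_one]
    simp

lemma powerSum_ne_top (d k : ℕ) : powerSum d k ≠ ⊤ :=
  ENNReal.sum_ne_top.2 fun _ _ => ENNReal.pow_ne_top (ENNReal.natCast_ne_top _)

lemma normalizedConst_ne_top (d k : ℕ) : normalizedConst d k ≠ ⊤ := by
  have h : 1 + (d : ℝ≥0∞) * powerSum d k ≠ ⊤ :=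
    ENNReal.add_ne_top.2 ⟨one_ne_top, ENNReal.mul_ne_top (ENNReal.natCast_ne_top _)
      (powerSum_ne_top d k)⟩
  exact ENNReal.mul_ne_top
    (ENNReal.pow_ne_top (ENNReal.mul_ne_top (ENNReal.natCast_ne_top _) h)) h

lemma volume_convexHull_le_of_isCompact (hd : 1 ≤ d) {k : ℕ} (hk : 1 ≤ k) {A : Set (Fin d → ℝ)}
    (hA : IsCompact A) (hsum : volume (kSum k A) < powerSum d k * volume A) :
    volume (convexHull ℝ A) ≤ 2 ^ d * normalizedConst d k * volume A := by
  have : Nonempty (Fin d) := ⟨⟨0, hd⟩⟩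
  have hA0 : volume A ≠ 0 := fun h => by simp [h] at hsum
  obtain ⟨T, hT, hend, hdiam, hco⟩ := exists_normalization hA hA0
  have hδ : ENNReal.ofReal |LinearMap.det T| ≠ 0 := by simpa using hT
  have hδ' : ENNReal.ofReal |LinearMap.det T| ≠ ⊤ := ENNReal.ofReal_ne_top
  have hTA : IsCompact (T '' A) := hA.image T.continuous_of_finiteDimensional
  have hnorm := one_le_normalizedConst_mul_volume hTA hend hdiam hk (by
    rw [kSum_image T A hk, Measure.addHaar_image_linearMap, Measure.addHaar_image_linearMap,
      mul_left_comm, Fintype.card_fin]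
    exact (ENNReal.mul_lt_mul_iff_right hδ hδ').2 hsum)
  rw [Fintype.card_fin, Measure.addHaar_image_linearMap] at hnorm
  rw [← LinearMap.image_convexHull, Measure.addHaar_image_linearMap] at hco
  refine (ENNReal.mul_le_mul_iff_right hδ hδ').1 ?_
  calc _ ≤ (2 : ℝ≥0∞) ^ d * 1 := by rwa [mul_one]
    _ ≤ 2 ^ d * (normalizedConst d k * (ENNReal.ofReal |LinearMap.det T| * volume A)) := by gcongr
    _ = _ := by ring

end Normalization

/-- Adjoining finitely many points of a nonempty set `A` to any set gives convex hulls whose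
volumes eventually reach that of the convex hull of `A`. -/
lemma exists_seq_volume_convexHull_le {d : ℕ} {A : Set (Fin d → ℝ)} (hA : A.Nonempty)
    (K : Set (Fin d → ℝ)) : ∃ u : ℕ → Fin d → ℝ, (∀ n, u n ∈ A) ∧
      volume (convexHull ℝ A) ≤ ⨆ n, volume (convexHull ℝ (K ∪ u '' Set.Iio n)) := by
  have : Nonempty A := hA.to_subtype
  obtain ⟨u, hu⟩ := TopologicalSpace.exists_dense_seq A
  refine ⟨fun n => u n, fun n => (u n).2, ?_⟩
  set B : ℕ → Set (Fin d → ℝ) := fun n =>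
    convexHull ℝ (K ∪ (fun n => (u n : Fin d → ℝ)) '' Set.Iio n) with hB
  have hmono : Monotone B := fun m n hmn => convexHull_mono
    (Set.union_subset_union_right _ (Set.image_mono (Set.Iio_subset_Iio hmn)))
  have hconv : Convex ℝ (⋃ n, B n) :=
    hmono.directed_le.convex_iUnion fun n => convex_convexHull ℝ _
  have hsub : convexHull ℝ A ⊆ closure (⋃ n, B n) := by
    refine convexHull_min (fun x hx => ?_) hconv.closure
    have hx' : (⟨x, hx⟩ : A) ∈ closure (Set.range u) := hu _
    refine closure_mono ?_ (image_closure_subset_closure_image continuous_subtype_val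
      ⟨_, hx', rfl⟩)
    rintro _ ⟨_, ⟨n, rfl⟩, rfl⟩
    exact Set.mem_iUnion.2 ⟨n + 1, subset_convexHull ℝ _ (Or.inr ⟨n, Nat.lt_succ_self n, rfl⟩)⟩
  calc volume (convexHull ℝ A) ≤ volume (closure (⋃ n, B n)) := measure_mono hsub
    _ = volume (⋃ n, B n) := by
      refine le_antisymm ?_ (measure_mono subset_closure)
      rw [closure_eq_self_union_frontier]
      exact (measure_union_le _ _).trans (by rw [hconv.addHaar_frontier volume, add_zero])
    _ = ⨆ n, volume (B n) := hmono.measure_iUnion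

/-- **Sharp threshold for iterated sumsets.**
For all `d, k ≥ 1` there is `C = C_{d,k} > 0` such that if `A ⊆ ℝ^d` is a
measurable set of positive finite volume with
`|k·A| < (1^d + 2^d + ⋯ + k^d)|A|`, then `|co(A)| ≤ C |A|`. -/
theorem iterated_sumsets_threshold (d k : ℕ) (hd : 1 ≤ d) (hk : 1 ≤ k) :
    ∃ C : ℝ, 0 < C ∧
      ∀ A : Set (Fin d → ℝ), MeasurableSet A →
        0 < volume A → volume A < ⊤ →
        volume (kSum k A) < (∑ i ∈ Finset.Icc 1 k, (i : ℝ≥0∞) ^ d) * volume A →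
        volume (convexHull ℝ A) ≤ ENNReal.ofReal C * volume A := by
  set C : ℝ≥0∞ := 2 ^ d * normalizedConst d k with hC
  have hCtop : C ≠ ⊤ := ENNReal.mul_ne_top (ENNReal.pow_ne_top (by simp))
    (normalizedConst_ne_top d k)
  refine ⟨C.toReal + 1, by positivity, fun A hA hA0 hAtop hsum => ?_⟩
  have hCle : C ≤ ENNReal.ofReal (C.toReal + 1) := by
    rw [ENNReal.le_ofReal_iff_toReal_le hCtop (by positivity)]
    linarith
  change _ < powerSum d k * volume A at hsum
  have hk0 : powerSum d k ≠ 0 := fun h => by simp [h] at hsum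
  obtain ⟨K, hKA, hK, hKv⟩ := hA.exists_lt_isCompact_of_ne_top hAtop.ne
    (ENNReal.div_lt_of_lt_mul' hsum)
  obtain ⟨u, hu, hle⟩ := exists_seq_volume_convexHull_le (nonempty_of_measure_ne_zero hA0.ne') K
  refine hle.trans (iSup_le fun n => ?_)
  have hBA : K ∪ u '' Set.Iio n ⊆ A := Set.union_subset hKA (by rintro _ ⟨m, -, rfl⟩; exact hu m)
  have hB : IsCompact (K ∪ u '' Set.Iio n) :=
    hK.union ((Set.finite_Iio n).image u).isCompact
  have hBsum : volume (kSum k (K ∪ u '' Set.Iio n)) <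
      powerSum d k * volume (K ∪ u '' Set.Iio n) := by
    refine (measure_mono (kSum_mono hBA hk)).trans_lt ?_
    rw [mul_comm]
    refine ((ENNReal.div_lt_iff (Or.inl hk0) (Or.inl (powerSum_ne_top d k))).1 hKv).trans_le ?_
    gcongr
    exact Set.subset_union_left
  calc _ ≤ C * volume (K ∪ u '' Set.Iio n) := volume_convexHull_le_of_isCompact hd hk hB hBsum
    _ ≤ ENNReal.ofReal (C.toReal + 1) * volume A := by gcongr
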